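/- arXiv:1701.07131 — 2 statements merged into one kernel-verified Lean document; each statement's English description precedes it below -/
import Mathlib

section
/- Assume the forward orbit {Φ(t, u₀) : t ≥ 0} of a point u₀ ∈ X has compact closure. Then for every v ∈ X the following are equivalent: (i) there exists a sequence tₙ → ∞ such that d_H(G•Φ(tₙ, u₀), G•v) → 0; (ii) there exists g ∈ G such that g•v belongs to the ω-limit set ω(u₀). In other words, the ω-limit set of the orbit of u₀ in the orbit space X/G (with the metric induced by Hausdorff distance between orbits) coincides with the image of ω(u₀) under the orbit projection. -/
open MulAction Metric Filter

theorem stmt9 {X G : Type*} [MetricSpace X] [Group G] [TopologicalSpace G]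
    [IsTopologicalGroup G] [CompactSpace G] [MulAction G X] [ContinuousSMul G X]
    (hiso : ∀ g : G, Isometry (fun x : X => g • x))
    (Φ : ℝ → X → X)
    (hΦ0 : ∀ u : X, Φ 0 u = u)
    (hΦadd : ∀ t ≥ (0:ℝ), ∀ s ≥ (0:ℝ), ∀ u : X, Φ (t + s) u = Φ t (Φ s u))
    (hΦcont : ContinuousOn (fun p : ℝ × X => Φ p.1 p.2) (Set.Ici 0 ×ˢ Set.univ))
    (hΦequiv : ∀ t ≥ (0:ℝ), ∀ (g : G) (u : X), Φ t (g • u) = g • Φ t u)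
    (u₀ : X)
    (hcomp : IsCompact (closure ((fun t => Φ t u₀) '' Set.Ici 0))) :
    ∀ v : X,
      (∃ tn : ℕ → ℝ, Tendsto tn atTop atTop ∧
          Tendsto (fun n => hausdorffDist (orbit G (Φ (tn n) u₀)) (orbit G v))
            atTop (nhds 0)) ↔
      (∃ g : G, g • v ∈ {w : X | ∃ tn : ℕ → ℝ, Tendsto tn atTop atTop ∧
          Tendsto (fun n => Φ (tn n) u₀) atTop (nhds w)}) := by
  intro v
  have hK : ∀ a : X, IsCompact (orbit G a) := fun a =>
    isCompact_range (continuous_id.smul continuous_const)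
  have hne : ∀ a : X, (orbit G a).Nonempty := fun a => ⟨a, mem_orbit_self a⟩
  constructor
  · rintro ⟨tn, htn, hd⟩
    have hev : ∀ᶠ n in atTop,
        Φ (tn n) u₀ ∈ closure ((fun t => Φ t u₀) '' Set.Ici 0) := by
      filter_upwards [htn.eventually_ge_atTop 0] with n hn
      exact subset_closure ⟨tn n, hn, rfl⟩
    obtain ⟨w, -, φ, hφ, hw⟩ := hcomp.tendsto_subseq' hev.frequently
    have h1 : Tendsto (fun n => infDist (Φ (tn (φ n)) u₀) (orbit G v)) atTop (nhds 0) := by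
      refine squeeze_zero (fun _ => infDist_nonneg) (fun n => ?_) (hd.comp hφ.tendsto_atTop)
      exact infDist_le_hausdorffDist_of_mem (mem_orbit_self _)
        (hausdorffEDist_ne_top_of_nonempty_of_bounded (hne _) (hne _)
          (hK _).isBounded (hK _).isBounded)
    have h2 : Tendsto (fun n => infDist (Φ (tn (φ n)) u₀) (orbit G v)) atTop
        (nhds (infDist w (orbit G v))) :=
      ((continuous_infDist_pt (orbit G v)).tendsto w).comp hw
    have h3 : w ∈ orbit G v :=
      ((hK v).isClosed.mem_iff_infDist_zero (hne v)).2 (tendsto_nhds_unique h2 h1)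
    obtain ⟨g, hg⟩ := h3
    refine ⟨g, fun n => tn (φ n), htn.comp hφ.tendsto_atTop, ?_⟩
    have hg' : g • v = w := hg
    rw [hg']
    exact hw
  · rintro ⟨g, tn, htn, hw⟩
    refine ⟨tn, htn, ?_⟩
    refine squeeze_zero (fun _ => hausdorffDist_nonneg) (fun n => ?_)
      (tendsto_iff_dist_tendsto_zero.1 hw)
    refine hausdorffDist_le_of_mem_dist dist_nonneg ?_ ?_
    · rintro _ ⟨h, rfl⟩
      refine ⟨h • g • v, ⟨h * g, mul_smul h g v⟩, ?_⟩
      exact ((hiso h).dist_eq _ _).le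
    · rintro _ ⟨h, rfl⟩
      refine ⟨(h * g⁻¹) • Φ (tn n) u₀, ⟨h * g⁻¹, rfl⟩, ?_⟩
      have e : h • v = (h * g⁻¹) • (g • v) := by simp [mul_smul]
      change dist (h • v) _ ≤ _
      rw [e, dist_comm]
      exact ((hiso (h * g⁻¹)).dist_eq _ _).le
end

section
/- Let u₁, u₂ ∈ X be points whose forward orbits {Φ(t, uᵢ) : t ≥ 0} have compact closure, and suppose there is a sequence tₙ → ∞ such that d_H(G•Φ(tₙ, u₁), G•Φ(tₙ, u₂)) → 0. Then there exist a subsequence (t_{n_k}), an element g* ∈ G, and a point u* ∈ ω(u₁) such that Φ(t_{n_k}, u₁) → u* and Φ(t_{n_k}, g*•u₂) → u* as k → ∞. -/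
open MulAction Metric Filter

theorem stmt10 {X G : Type*} [MetricSpace X] [Group G] [TopologicalSpace G]
    [IsTopologicalGroup G] [CompactSpace G] [MulAction G X] [ContinuousSMul G X]
    (hiso : ∀ g : G, Isometry (fun x : X => g • x))
    (Φ : ℝ → X → X)
    (hΦ0 : ∀ u : X, Φ 0 u = u)
    (hΦadd : ∀ t ≥ (0:ℝ), ∀ s ≥ (0:ℝ), ∀ u : X, Φ (t + s) u = Φ t (Φ s u))
    (hΦcont : ContinuousOn (fun p : ℝ × X => Φ p.1 p.2) (Set.Ici 0 ×ˢ Set.univ))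
    (hΦequiv : ∀ t ≥ (0:ℝ), ∀ (g : G) (u : X), Φ t (g • u) = g • Φ t u)
    (u₁ u₂ : X)
    (hcomp₁ : IsCompact (closure ((fun t => Φ t u₁) '' Set.Ici 0)))
    (hcomp₂ : IsCompact (closure ((fun t => Φ t u₂) '' Set.Ici 0)))
    (tn : ℕ → ℝ) (htn : Tendsto tn atTop atTop)
    (hd : Tendsto
      (fun n => hausdorffDist (orbit G (Φ (tn n) u₁)) (orbit G (Φ (tn n) u₂)))
      atTop (nhds 0)) :
    ∃ k : ℕ → ℕ, StrictMono k ∧ ∃ (gstar : G) (ustar : X),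
      (∃ sn : ℕ → ℝ, Tendsto sn atTop atTop ∧
        Tendsto (fun n => Φ (sn n) u₁) atTop (nhds ustar)) ∧
      Tendsto (fun n => Φ (tn (k n)) u₁) atTop (nhds ustar) ∧
      Tendsto (fun n => Φ (tn (k n)) (gstar • u₂)) atTop (nhds ustar) := by
  have hev : ∀ᶠ n in atTop, 0 ≤ tn n := htn.eventually_ge_atTop 0
  have horb : ∀ x : X, IsCompact (orbit G x) := fun x =>
    isCompact_range (continuous_id.smul continuous_const)
  obtain ⟨a, -, φ, hφ, ha⟩ := hcomp₁.tendsto_subseq' (x := fun n => Φ (tn n) u₁)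
    (hev.mono fun n hn => subset_closure (Set.mem_image_of_mem (fun t => Φ t u₁) hn)).frequently
  obtain ⟨b, -, ψ, hψ, hb⟩ := hcomp₂.tendsto_subseq' (x := fun n => Φ (tn (φ n)) u₂)
    ((hφ.tendsto_atTop.eventually hev).mono
      fun n hn => subset_closure (Set.mem_image_of_mem (fun t => Φ t u₂) hn)).frequently
  have hk : StrictMono (φ ∘ ψ) := hφ.comp hψ
  have ha' : Tendsto (fun n => Φ (tn ((φ ∘ ψ) n)) u₁) atTop (nhds a) :=
    ha.comp hψ.tendsto_atTop
  have hb' : Tendsto (fun n => Φ (tn ((φ ∘ ψ) n)) u₂) atTop (nhds b) := hb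
  have hmem : a ∈ orbit G b := by
    rw [← (horb b).isClosed.closure_eq, Metric.mem_closure_iff]
    intro ε hε
    have hε3 : 0 < ε / 3 := by positivity
    have h1 := (Metric.tendsto_nhds.1 ha') _ hε3
    have h2 := (Metric.tendsto_nhds.1 hb') _ hε3
    have h3 := (hd.comp hk.tendsto_atTop).eventually (gt_mem_nhds hε3)
    obtain ⟨n, h1, h2, h3⟩ := (h1.and (h2.and h3)).exists
    obtain ⟨_, ⟨g, rfl⟩, hg⟩ := exists_dist_lt_of_hausdorffDist_lt
      (mem_orbit_self (M := G) (Φ (tn ((φ ∘ ψ) n)) u₁)) h3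
      (hausdorffEDist_ne_top_of_nonempty_of_bounded (nonempty_orbit _) (nonempty_orbit _)
        (horb _).isBounded (horb _).isBounded)
    refine ⟨g • b, mem_orbit _ _, ?_⟩
    have h4 := (hiso g).dist_eq (Φ (tn ((φ ∘ ψ) n)) u₂) b
    have h5 := dist_triangle4 a (Φ (tn ((φ ∘ ψ) n)) u₁) (g • Φ (tn ((φ ∘ ψ) n)) u₂) (g • b)
    rw [dist_comm] at h1
    simp only [] at h4 hg
    linarith
  obtain ⟨g, hg⟩ := hmem
  refine ⟨φ ∘ ψ, hk, g, a, ⟨fun n => tn ((φ ∘ ψ) n), htn.comp hk.tendsto_atTop, ha'⟩, ha', ?_⟩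
  have h6 : Tendsto (fun n => g • Φ (tn ((φ ∘ ψ) n)) u₂) atTop (nhds a) := by
    rw [← hg]
    exact ((hiso g).continuous.tendsto b).comp hb'
  refine h6.congr' ?_
  filter_upwards [hk.tendsto_atTop.eventually hev] with n hn
  exact (hΦequiv _ hn g u₂).symm
end
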